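/- Let ρ_A be a 2×2 density matrix and ρ_BC a 4×4 density matrix, and let ρ = ρ_A ⊗ ρ_BC (Kronecker product, an 8×8 density matrix). Then for all unit vectors n1, n2 ∈ ℝ³ the four expectations factorize: Tr(O1·ρ) = Tr(σ_{n1}·ρ_A)·Tr((σ_{n2}⊗σ_{n2})·ρ_BC), Tr(O2·ρ) = Tr(σ_{n2}·ρ_A)·Tr((σ_{n1}⊗σ_{n2})·ρ_BC), Tr(O3·ρ) = Tr(σ_{n2}·ρ_A)·Tr((σ_{n2}⊗σ_{n1})·ρ_BC), Tr(O4·ρ) = Tr(σ_{n1}·ρ_A)·Tr((σ_{n1}⊗σ_{n1})·ρ_BC). Moreover, for the specific biseparable state ρ_A = |0⟩⟨0| and ρ_BC = |Φ⁺⟩⟨Φ⁺| with Φ⁺ = (|00⟩+|11⟩)/√2 and the orthogonal directions n1 = ẑ, n2 = x̂, one obtains I(ẑ,x̂;ρ) = 1. -/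

import Mathlib

open Matrix Kronecker
open scoped ComplexOrder

noncomputable section

/-- Pauli matrices. -/
def σx : Matrix (Fin 2) (Fin 2) ℂ := !![0, 1; 1, 0]
def σy : Matrix (Fin 2) (Fin 2) ℂ := !![0, -Complex.I; Complex.I, 0]
def σz : Matrix (Fin 2) (Fin 2) ℂ := !![1, 0; 0, -1]

/-- Spin observable along direction `n`. -/
def spin (n : Fin 3 → ℝ) : Matrix (Fin 2) (Fin 2) ℂ :=
  (n 0 : ℂ) • σx + (n 1 : ℂ) • σy + (n 2 : ℂ) • σz

/-- Index type for three qubits, grouped as `A | BC`. -/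
abbrev Q3 := Fin 2 × (Fin 2 × Fin 2)

/-- `n` is a unit vector in `ℝ³`. -/
def IsUnitVec (n : Fin 3 → ℝ) : Prop := n 0 ^ 2 + n 1 ^ 2 + n 2 ^ 2 = 1

def O1 (n1 n2 : Fin 3 → ℝ) : Matrix Q3 Q3 ℂ := spin n1 ⊗ₖ (spin n2 ⊗ₖ spin n2)
def O2 (n1 n2 : Fin 3 → ℝ) : Matrix Q3 Q3 ℂ := spin n2 ⊗ₖ (spin n1 ⊗ₖ spin n2)
def O3 (n1 n2 : Fin 3 → ℝ) : Matrix Q3 Q3 ℂ := spin n2 ⊗ₖ (spin n2 ⊗ₖ spin n1)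
def O4 (n1 n2 : Fin 3 → ℝ) : Matrix Q3 Q3 ℂ := spin n1 ⊗ₖ (spin n1 ⊗ₖ spin n1)

/-- The functional `I(n1,n2;ρ) = e₄ − e₁e₂e₃` with `eᵢ = Re Tr(Oᵢ ρ)`. -/
def Ifun (n1 n2 : Fin 3 → ℝ) (ρ : Matrix Q3 Q3 ℂ) : ℝ :=
  ((O4 n1 n2 * ρ).trace).re -
    ((O1 n1 n2 * ρ).trace).re * ((O2 n1 n2 * ρ).trace).re * ((O3 n1 n2 * ρ).trace).re

/-- The single-qubit state `|0⟩`. -/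
def ket0 : Fin 2 → ℂ := ![1, 0]

/-- The Bell state `Φ⁺ = (|00⟩ + |11⟩)/√2`. -/
def Φplus : Fin 2 × Fin 2 → ℂ := fun p =>
  ((Real.sqrt 2 : ℂ))⁻¹ * (if p = (0, 0) then 1 else if p = (1, 1) then 1 else 0)

lemma trace_kronecker_mul_kronecker {R m n : Type*} [CommSemiring R] [Fintype m] [Fintype n]
    (A C : Matrix m m R) (B D : Matrix n n R) :
    ((A ⊗ₖ B) * (C ⊗ₖ D)).trace = (A * C).trace * (B * D).trace := by
  rw [← mul_kronecker_mul, trace_kronecker]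

lemma spin_z : spin ![0, 0, 1] = σz := by
  simp [spin]

lemma spin_x : spin ![1, 0, 0] = σx := by
  simp [spin]

lemma trace_σz_mul_ket0 : (σz * vecMulVec ket0 (star ket0)).trace = 1 := by
  rw [mul_vecMulVec, trace_vecMulVec]
  simp [σz, ket0]

lemma trace_σx_mul_ket0 : (σx * vecMulVec ket0 (star ket0)).trace = 0 := by
  rw [mul_vecMulVec, trace_vecMulVec]
  simp [σx, ket0]

lemma trace_σz_kronecker_σz_mul_Φplus :
    ((σz ⊗ₖ σz) * vecMulVec Φplus (star Φplus)).trace = 1 := by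
  have h : ((Real.sqrt 2 : ℂ))⁻¹ * ((Real.sqrt 2 : ℂ))⁻¹ = 1 / 2 := by
    rw [← mul_inv, ← Complex.ofReal_mul, Real.mul_self_sqrt zero_le_two]
    norm_num
  simp [σz, Φplus, trace, mul_apply, vecMulVec_apply, Fintype.sum_prod_type, h]
  norm_num

theorem biseparable_factorization (ρA : Matrix (Fin 2) (Fin 2) ℂ)
    (hA : ρA.PosSemidef) (htrA : ρA.trace = 1)
    (ρBC : Matrix (Fin 2 × Fin 2) (Fin 2 × Fin 2) ℂ)
    (hBC : ρBC.PosSemidef) (htrBC : ρBC.trace = 1) :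
    (∀ n1 n2 : Fin 3 → ℝ, IsUnitVec n1 → IsUnitVec n2 →
      (O1 n1 n2 * (ρA ⊗ₖ ρBC)).trace =
          (spin n1 * ρA).trace * ((spin n2 ⊗ₖ spin n2) * ρBC).trace ∧
      (O2 n1 n2 * (ρA ⊗ₖ ρBC)).trace =
          (spin n2 * ρA).trace * ((spin n1 ⊗ₖ spin n2) * ρBC).trace ∧
      (O3 n1 n2 * (ρA ⊗ₖ ρBC)).trace =
          (spin n2 * ρA).trace * ((spin n2 ⊗ₖ spin n1) * ρBC).trace ∧
      (O4 n1 n2 * (ρA ⊗ₖ ρBC)).trace =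
          (spin n1 * ρA).trace * ((spin n1 ⊗ₖ spin n1) * ρBC).trace) ∧
    (ρA = vecMulVec ket0 (star ket0) → ρBC = vecMulVec Φplus (star Φplus) →
      Ifun ![0, 0, 1] ![1, 0, 0] (ρA ⊗ₖ ρBC) = 1) := by
  refine ⟨fun n1 n2 _ _ => ⟨trace_kronecker_mul_kronecker .., trace_kronecker_mul_kronecker ..,
    trace_kronecker_mul_kronecker .., trace_kronecker_mul_kronecker ..⟩, ?_⟩
  rintro rfl rfl
  simp only [Ifun, O1, O2, O3, O4, trace_kronecker_mul_kronecker, spin_z, spin_x,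
    trace_σz_mul_ket0, trace_σx_mul_ket0, trace_σz_kronecker_σz_mul_Φplus]
  simp

end
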